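/- arXiv:1911.04516 — 5 statements merged into one kernel-verified Lean document; each statement's English description precedes it below -/
import Mathlib

section
/- Let G be a finite group and H ≤ G a subgroup such that the overgroup lattice O_G(H) is Boolean of rank ℓ with ℓ ≤ 3. Then the dual Euler totient satisfies φ̂(H,G) ≥ 2^{ℓ−1}; in particular φ̂(H,G) ≠ 0. -/
/-- The dual Euler totient of the Boolean interval `[H, G]` of rank `ℓ`,
computed from an order isomorphism `e` of the interval with the Boolean lattice
of all subsets of `Fin ℓ`: the atoms of the interval are `A i = e.symm {i}`, and
`φ̂(H,G) = Σ_{I ⊆ Fin ℓ} (−1)^{|I|} · |G : ⋁_{i∈I} A i|`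
(the join over the empty set being `H`). -/
noncomputable def dualEulerTotient {G : Type*} [Group G] (H : Subgroup G) {ℓ : ℕ}
    (e : Set.Ici H ≃o Finset (Fin ℓ)) : ℤ :=
  ∑ I : Finset (Fin ℓ),
    (-1 : ℤ) ^ I.card *
      (((I.sup fun i => ((e.symm {i}).1 : Subgroup G)) ⊔ H).index : ℤ)

namespace Subgroup

variable {G : Type*} [Group G]

theorem relIndex_sup_of_le_normalizer {H N : Subgroup G} (h : H ≤ normalizer N) :
    N.relIndex (H ⊔ N) = N.relIndex H := by
  have := normal_subgroupOf_of_le_normalizer h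
  have := normal_subgroupOf_sup_of_le_normalizer h
  exact Nat.card_congr (QuotientGroup.quotientInfEquivProdNormalizerQuotient H N h).toEquiv.symm

theorem mul_mem_iff_of_relIndex_two {H K : Subgroup G} (h : H.relIndex K = 2) {a b : G}
    (ha : a ∈ K) (hb : b ∈ K) : a * b ∈ H ↔ (a ∈ H ↔ b ∈ H) :=
  mul_mem_iff_of_index_two (H := H.subgroupOf K) h (a := ⟨a, ha⟩) (b := ⟨b, hb⟩)

theorem le_normalizer_of_relIndex_two {H K : Subgroup G} (hHK : H ≤ K) (h : H.relIndex K = 2) :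
    K ≤ normalizer H := by
  have := normal_of_index_eq_two (H := H.subgroupOf K) h
  exact le_normalizer_of_normal_subgroupOf hHK

/-- The third subgroup between `A ⊓ B` and `M` when `A`, `B` have index two in `M`:
the elements of `M` lying in both or in neither of `A` and `B`. -/
def diagonalOfRelIndexTwo {A B M : Subgroup G} (hA : A.relIndex M = 2) (hB : B.relIndex M = 2) :
    Subgroup G where
  carrier := {g | g ∈ M ∧ (g ∈ A ↔ g ∈ B)}
  one_mem' := by simp
  mul_mem' := by
    rintro a b ⟨ha, hab⟩ ⟨hb, hbb⟩
    refine ⟨mul_mem ha hb, ?_⟩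
    rw [mul_mem_iff_of_relIndex_two hA ha hb, mul_mem_iff_of_relIndex_two hB ha hb, hab, hbb]
  inv_mem' := by
    rintro a ⟨ha, hab⟩
    exact ⟨inv_mem ha, by simpa using hab⟩

end Subgroup

namespace BooleanInterval

variable {G : Type*} [Group G] {H : Subgroup G} {ℓ : ℕ} (e : Set.Ici H ≃o Finset (Fin ℓ))

/-- The overgroup of `H` corresponding to a subset of `Fin ℓ`. -/
def overgroup (S : Finset (Fin ℓ)) : Subgroup G := (e.symm S).1

theorem le_overgroup (S : Finset (Fin ℓ)) : H ≤ overgroup e S := (e.symm S).2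

theorem overgroup_le_iff {S T : Finset (Fin ℓ)} : overgroup e S ≤ overgroup e T ↔ S ⊆ T :=
  e.symm.le_iff_le

theorem exists_overgroup_eq {K : Subgroup G} (hK : H ≤ K) : ∃ S, overgroup e S = K :=
  ⟨e ⟨K, hK⟩, by simp [overgroup]⟩

theorem overgroup_empty : overgroup e ∅ = H := by
  obtain ⟨S, hS⟩ := exists_overgroup_eq e le_rfl
  refine le_antisymm ?_ (le_overgroup e ∅)
  conv_rhs => rw [← hS]
  exact (overgroup_le_iff e).2 (Finset.empty_subset S)

theorem overgroup_univ : overgroup e Finset.univ = ⊤ := by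
  obtain ⟨S, hS⟩ := exists_overgroup_eq e (le_top : H ≤ ⊤)
  rw [eq_top_iff, ← hS, overgroup_le_iff]
  exact Finset.subset_univ S

theorem overgroup_union (S T : Finset (Fin ℓ)) :
    overgroup e (S ∪ T) = overgroup e S ⊔ overgroup e T := by
  apply le_antisymm
  · obtain ⟨U, hU⟩ := exists_overgroup_eq e
      ((le_overgroup e S).trans (le_sup_left : _ ≤ overgroup e S ⊔ overgroup e T))
    rw [← hU, overgroup_le_iff]
    refine Finset.union_subset ?_ ?_ <;> rw [← overgroup_le_iff e, hU]
    exacts [le_sup_left, le_sup_right]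
  · exact sup_le ((overgroup_le_iff e).2 Finset.subset_union_left)
      ((overgroup_le_iff e).2 Finset.subset_union_right)

theorem overgroup_inter (S T : Finset (Fin ℓ)) :
    overgroup e (S ∩ T) = overgroup e S ⊓ overgroup e T := by
  apply le_antisymm
  · exact le_inf ((overgroup_le_iff e).2 Finset.inter_subset_left)
      ((overgroup_le_iff e).2 Finset.inter_subset_right)
  · obtain ⟨U, hU⟩ := exists_overgroup_eq e (le_inf (le_overgroup e S) (le_overgroup e T))
    rw [← hU, overgroup_le_iff]
    refine Finset.subset_inter ?_ ?_ <;> rw [← overgroup_le_iff e, hU]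
    exacts [inf_le_left, inf_le_right]

theorem sup_atoms_sup (I : Finset (Fin ℓ)) :
    (I.sup fun i => ((e.symm {i}).1 : Subgroup G)) ⊔ H = overgroup e I := by
  induction I using Finset.induction_on with
  | empty => simp [overgroup_empty]
  | insert i S hi ih =>
    rw [Finset.sup_insert, sup_assoc, ih, Finset.insert_eq, overgroup_union]
    rfl

theorem dualEulerTotient_eq_sum :
    dualEulerTotient H e = ∑ I : Finset (Fin ℓ), (-1 : ℤ) ^ I.card * (overgroup e I).index := by
  simp only [dualEulerTotient, sup_atoms_sup]

open Subgroup

/-- An atom of index two over `H` normalizes every member of the interval. -/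
theorem atom_le_normalizer {i : Fin ℓ} (h : H.relIndex (overgroup e {i}) = 2)
    (S : Finset (Fin ℓ)) : overgroup e {i} ≤ normalizer (overgroup e S) := by
  have hN := le_normalizer_of_relIndex_two (le_overgroup e {i}) h
  have key : ∀ g ∈ overgroup e {i}, ∀ x ∈ overgroup e S, g * x * g⁻¹ ∈ overgroup e S := by
    by_cases hi : i ∈ S
    · intro g hg x hx
      have hg' : g ∈ overgroup e S :=
        (overgroup_le_iff e).2 (Finset.singleton_subset_iff.2 hi) hg
      exact mul_mem (mul_mem hg' hx) (inv_mem hg')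
    intro g hg x hx
    set B := (overgroup e S).map (MulAut.conj g).toMonoidHom with hB
    have mem_B : ∀ y, y ∈ B ↔ g⁻¹ * y * g ∈ overgroup e S := by
      intro y
      rw [hB, Subgroup.mem_map]
      constructor
      · rintro ⟨z, hz, rfl⟩
        simpa [mul_assoc] using hz
      · intro hy
        exact ⟨_, hy, by simp [mul_assoc]⟩
    have hHB : H ≤ B := fun y hy =>
      (mem_B y).2 (le_overgroup e S ((mem_normalizer_iff''.1 (hN hg) y).1 hy))
    obtain ⟨T, hT⟩ := exists_overgroup_eq e hHB
    have hTS : T ⊆ insert i S := by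
      rw [← overgroup_le_iff e, hT]
      intro y hy
      have hgS : g ∈ overgroup e (insert i S) :=
        (overgroup_le_iff e).2 (by simp) hg
      have hyS := (overgroup_le_iff e).2 (Finset.subset_insert i S) ((mem_B y).1 hy)
      simpa [mul_assoc] using mul_mem (mul_mem hgS hyS) (inv_mem hgS)
    have hiT : i ∉ T := by
      intro hiT
      apply hi
      rw [← Finset.singleton_subset_iff, ← overgroup_le_iff e]
      intro y hy
      have : g * y * g⁻¹ ∈ B := by
        rw [← hT]
        exact (overgroup_le_iff e).2 (Finset.singleton_subset_iff.2 hiT)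
          (mul_mem (mul_mem hg hy) (inv_mem hg))
      simpa [mul_assoc] using (mem_B _).1 this
    have hBS : B ≤ overgroup e S := by
      rw [← hT, overgroup_le_iff]
      exact (Finset.subset_insert_iff_of_notMem hiT).1 hTS
    exact hBS ((mem_B _).2 (by simpa [mul_assoc] using hx))
  intro g hg
  refine mem_normalizer_iff.2 fun x => ⟨key g hg x, fun hx => ?_⟩
  simpa [mul_assoc] using key g⁻¹ (inv_mem hg) _ hx

theorem relIndex_insert {i : Fin ℓ} (h : H.relIndex (overgroup e {i}) = 2)
    {S : Finset (Fin ℓ)} (hi : i ∉ S) :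
    (overgroup e S).relIndex (overgroup e (insert i S)) = 2 := by
  rw [Finset.insert_eq, overgroup_union, relIndex_sup_of_le_normalizer (atom_le_normalizer e h S),
    ← inf_relIndex_right, ← overgroup_inter, Finset.inter_singleton_of_notMem hi, overgroup_empty, h]

theorem index_eq_two_mul_index_insert {i : Fin ℓ} (h : H.relIndex (overgroup e {i}) = 2)
    {S : Finset (Fin ℓ)} (hi : i ∉ S) :
    (overgroup e S).index = 2 * (overgroup e (insert i S)).index := by
  rw [← relIndex_mul_index ((overgroup_le_iff e).2 (Finset.subset_insert i S)),
    relIndex_insert e h hi]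

/-- At most one atom has index two over `H`. -/
theorem eq_of_relIndex_eq_two {i j : Fin ℓ} (hi : H.relIndex (overgroup e {i}) = 2)
    (hj : H.relIndex (overgroup e {j}) = 2) : i = j := by
  by_contra hij
  have hA : (overgroup e {i}).relIndex (overgroup e {i, j}) = 2 := by
    rw [Finset.pair_comm]
    exact relIndex_insert e hj (by simpa using Ne.symm hij)
  have hB : (overgroup e {j}).relIndex (overgroup e {i, j}) = 2 :=
    relIndex_insert e hi (by simpa using hij)
  obtain ⟨a, haA, haB⟩ := SetLike.not_le_iff_exists.1
    (mt (overgroup_le_iff e (S := {i}) (T := {j})).1 (by simpa using hij))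
  obtain ⟨b, hbB, hbA⟩ := SetLike.not_le_iff_exists.1
    (mt (overgroup_le_iff e (S := {j}) (T := {i})).1 (by simpa using Ne.symm hij))
  have haM : a ∈ overgroup e {i, j} := (overgroup_le_iff e).2 (by simp) haA
  have hbM : b ∈ overgroup e {i, j} := (overgroup_le_iff e).2 (by simp) hbB
  have hD : H ≤ diagonalOfRelIndexTwo hA hB := fun x hx =>
    ⟨le_overgroup e _ hx, by simp [le_overgroup e _ hx]⟩
  obtain ⟨T, hT⟩ := exists_overgroup_eq e hD
  have hTM : T ⊆ {i, j} := by
    rw [← overgroup_le_iff e, hT]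
    exact fun x hx => hx.1
  have hiT : i ∉ T := fun h => haB <| by
    have : a ∈ diagonalOfRelIndexTwo hA hB := by
      rw [← hT]
      exact (overgroup_le_iff e).2 (Finset.singleton_subset_iff.2 h) haA
    exact this.2.1 haA
  have hjT : j ∉ T := fun h => hbA <| by
    have : b ∈ diagonalOfRelIndexTwo hA hB := by
      rw [← hT]
      exact (overgroup_le_iff e).2 (Finset.singleton_subset_iff.2 h) hbB
    exact this.2.2 hbB
  have hT0 : T = ∅ := by
    refine Finset.eq_empty_of_forall_notMem fun k hk => ?_
    have := hTM hk
    simp only [Finset.mem_insert, Finset.mem_singleton] at this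
    rcases this with rfl | rfl <;> contradiction
  have hab : a * b ∈ diagonalOfRelIndexTwo hA hB := by
    refine ⟨mul_mem haM hbM, ?_⟩
    rw [mul_mem_iff_of_relIndex_two hA haM hbM, mul_mem_iff_of_relIndex_two hB haM hbM]
    simp [haA, hbA, haB, hbB]
  rw [← hT, hT0, overgroup_empty] at hab
  exact hbA ((mul_mem_cancel_left haA).1 (le_overgroup e _ hab))

variable [Finite G]

theorem two_le_relIndex {S T : Finset (Fin ℓ)} (h : ¬T ⊆ S) :
    2 ≤ (overgroup e S).relIndex (overgroup e T) := by
  have h0 : (overgroup e S).relIndex (overgroup e T) ≠ 0 :=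
    mt index_eq_zero_of_relIndex_eq_zero index_ne_zero_of_finite
  have h1 : (overgroup e S).relIndex (overgroup e T) ≠ 1 := by
    rwa [Ne, relIndex_eq_one, overgroup_le_iff]
  omega

theorem two_le_index {S : Finset (Fin ℓ)} (h : S ≠ Finset.univ) : 2 ≤ (overgroup e S).index := by
  rw [← relIndex_top_right, ← overgroup_univ e]
  exact two_le_relIndex e (by simpa using h)

theorem two_mul_index_le (i : Fin ℓ) : 2 * (overgroup e {i}).index ≤ H.index := by
  rw [← relIndex_mul_index (le_overgroup e {i})]
  have := two_le_relIndex e (S := ∅) (T := {i}) (by simp)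
  rw [overgroup_empty] at this
  gcongr

theorem three_mul_index_le {i : Fin ℓ} (h : H.relIndex (overgroup e {i}) ≠ 2) :
    3 * (overgroup e {i}).index ≤ H.index := by
  rw [← relIndex_mul_index (le_overgroup e {i})]
  have := two_le_relIndex e (S := ∅) (T := {i}) (by simp)
  rw [overgroup_empty] at this
  gcongr
  omega

/-- Distinct atoms satisfy `|A i : H| ≤ |A i ⊔ A j : A j|`. -/
theorem relIndex_atom_le {i j : Fin ℓ} (hij : i ≠ j) :
    H.relIndex (overgroup e {i}) ≤ (overgroup e {j}).relIndex (overgroup e {i, j}) := by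
  have hH : overgroup e {j} ⊓ overgroup e {i} = H := by
    rw [← overgroup_inter, Finset.inter_singleton_of_notMem (by simpa using hij), overgroup_empty]
  have hrel := inf_relIndex_right (overgroup e {j}) (overgroup e {i})
  rw [hH] at hrel
  rw [hrel]
  exact relIndex_le_of_le_right ((overgroup_le_iff e).2 (by simp))
    (mt index_eq_zero_of_relIndex_eq_zero index_ne_zero_of_finite)

theorem two_le_of_rank_two (e : Set.Ici H ≃o Finset (Fin 2)) :
    2 ≤ (H.index : ℤ) - (overgroup e {0}).index - (overgroup e {1}).index + 1 := by
  have h0 := two_mul_index_le e 0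
  have h1 := two_mul_index_le e 1
  have hp := two_le_index e (S := {0}) (by decide)
  by_cases h : H.relIndex (overgroup e {0}) = 2
  · have h' : H.relIndex (overgroup e {1}) ≠ 2 := fun h' =>
      absurd (eq_of_relIndex_eq_two e h h') (by decide)
    have := three_mul_index_le e h'
    omega
  · have := three_mul_index_le e h
    omega

theorem four_le_of_relIndex_eq_two (e : Set.Ici H ≃o Finset (Fin 3)) {i j k : Fin 3}
    (hij : i ≠ j) (hik : i ≠ k) (hjk : j ≠ k) (h : H.relIndex (overgroup e {i}) = 2) :
    4 ≤ (H.index : ℤ) - (overgroup e {i}).index - (overgroup e {j}).index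
      - (overgroup e {k}).index + (overgroup e {i, j}).index + (overgroup e {i, k}).index
      + (overgroup e {j, k}).index - 1 := by
  have hj : H.relIndex (overgroup e {j}) ≠ 2 := fun h' => hij (eq_of_relIndex_eq_two e h h')
  have hk : H.relIndex (overgroup e {k}) ≠ 2 := fun h' => hik (eq_of_relIndex_eq_two e h h')
  have e0 := index_eq_two_mul_index_insert e h (S := ∅) (by simp)
  have ej := index_eq_two_mul_index_insert e h (S := {j}) (by simpa using hij)
  have ek := index_eq_two_mul_index_insert e h (S := {k}) (by simpa using hik)
  have ejk := index_eq_two_mul_index_insert e h (S := {j, k}) (by simp [hij, hik])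
  have huniv : (insert i {j, k} : Finset (Fin 3)) = Finset.univ := by
    clear * - hij hik hjk
    revert i j k; decide
  rw [huniv, overgroup_univ, index_top] at ejk
  rw [overgroup_empty, insert_empty_eq] at e0
  have tj := three_mul_index_le e hj
  have tk := three_mul_index_le e hk
  have hle := relIndex_atom_le e hjk
  have hm := relIndex_mul_index
    ((overgroup_le_iff e).2 (by simp : ({k} : Finset (Fin 3)) ⊆ {j, k}))
  rw [ejk] at hm
  have hj2 := two_le_relIndex e (S := ∅) (T := {j}) (by simp)
  rw [overgroup_empty] at hj2
  omega

theorem four_le_of_rank_three (e : Set.Ici H ≃o Finset (Fin 3)) :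
    4 ≤ (H.index : ℤ) - (overgroup e {0}).index - (overgroup e {1}).index
      - (overgroup e {2}).index + (overgroup e {0, 1}).index + (overgroup e {0, 2}).index
      + (overgroup e {1, 2}).index - 1 := by
  by_cases h0 : H.relIndex (overgroup e {0}) = 2
  · exact four_le_of_relIndex_eq_two e (by decide) (by decide) (by decide) h0
  by_cases h1 : H.relIndex (overgroup e {1}) = 2
  · have := four_le_of_relIndex_eq_two e (i := 1) (j := 0) (k := 2)
      (by decide) (by decide) (by decide) h1
    rw [Finset.pair_comm 1 0] at this
    linarith
  by_cases h2 : H.relIndex (overgroup e {2}) = 2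
  · have := four_le_of_relIndex_eq_two e (i := 2) (j := 0) (k := 1)
      (by decide) (by decide) (by decide) h2
    rw [Finset.pair_comm 2 0, Finset.pair_comm 2 1] at this
    linarith
  have t0 := three_mul_index_le e h0
  have t1 := three_mul_index_le e h1
  have t2 := three_mul_index_le e h2
  have m01 := two_le_index e (S := {0, 1}) (by decide)
  have m02 := two_le_index e (S := {0, 2}) (by decide)
  have m12 := two_le_index e (S := {1, 2}) (by decide)
  omega

end BooleanInterval

open BooleanInterval in
/-- If `G` is a finite group and `H ≤ G` is a subgroup such that the
overgroup lattice `O_G(H)` is Boolean of rank `ℓ ≤ 3`, then the dual Euler totient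
satisfies `φ̂(H,G) ≥ 2^(ℓ−1)`; in particular `φ̂(H,G) ≠ 0`. -/
theorem statement2 {G : Type*} [Group G] [Finite G] (H : Subgroup G) {ℓ : ℕ}
    (hℓ : ℓ ≤ 3) (e : Set.Ici H ≃o Finset (Fin ℓ)) :
    (2 : ℤ) ^ (ℓ - 1) ≤ dualEulerTotient H e ∧ dualEulerTotient H e ≠ 0 := by
  suffices h : (2 : ℤ) ^ (ℓ - 1) ≤ dualEulerTotient H e from
    ⟨h, (lt_of_lt_of_le (by positivity) h).ne'⟩
  rw [dualEulerTotient_eq_sum]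
  have hu := overgroup_univ e
  have h0 := overgroup_empty e
  interval_cases ℓ
  · have hs : (Finset.univ : Finset (Finset (Fin 0))) = {Finset.univ} := by decide
    rw [hs, Finset.sum_singleton, hu]
    simp
  · have hs : (Finset.univ : Finset (Finset (Fin 1))) = {∅, Finset.univ} := by decide
    have := two_le_index e (S := ∅) (by decide)
    rw [hs, Finset.sum_pair (by decide), hu]
    simp
    omega
  · have hs : (Finset.univ : Finset (Finset (Fin 2))) = {∅, {0}, {1}, Finset.univ} := by decide
    have := two_le_of_rank_two e
    rw [hs, Finset.sum_insert (by decide), Finset.sum_insert (by decide),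
      Finset.sum_pair (by decide), hu, h0]
    simp
    linarith
  · have hs : (Finset.univ : Finset (Finset (Fin 3))) =
        {∅, {0}, {1}, {2}, {0, 1}, {0, 2}, {1, 2}, Finset.univ} := by decide
    have := four_le_of_rank_three e
    rw [hs, Finset.sum_insert (by decide), Finset.sum_insert (by decide),
      Finset.sum_insert (by decide), Finset.sum_insert (by decide),
      Finset.sum_insert (by decide), Finset.sum_insert (by decide),
      Finset.sum_pair (by decide), hu, h0]
    simp
    linarith
end

section
/- Let G be a finite group and H ≤ G a subgroup such that the overgroup lattice O_G(H) is Boolean of rank ℓ and group-complemented, i.e. K·K^∁ = K^∁·K (as subsets of G) for every K ∈ O_G(H). Then the dual Euler totient satisfies φ̂(H,G) ≥ 2^{ℓ−1}; in particular φ̂(H,G) ≠ 0. -/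
open scoped Pointwise

section Products

variable {G : Type*} [Group G]

/-- If two subgroups permute, every element of their join is a product. -/
theorem Subgroup.coe_sup_subset_mul_of_mul_comm {A B : Subgroup G}
    (h : (A : Set G) * (B : Set G) = (B : Set G) * (A : Set G)) :
    ((A ⊔ B : Subgroup G) : Set G) ⊆ (A : Set G) * (B : Set G) := by
  let K : Subgroup G :=
    { carrier := (A : Set G) * (B : Set G)
      one_mem' := ⟨1, A.one_mem, 1, B.one_mem, one_mul 1⟩
      mul_mem' := by
        intro x y hx hy
        have hxy : x * y ∈ ((A : Set G) * B) * ((A : Set G) * B) := Set.mul_mem_mul hx hy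
        rwa [mul_assoc, ← mul_assoc (B : Set G), ← h, mul_assoc, coe_mul_coe,
          ← mul_assoc, coe_mul_coe] at hxy
      inv_mem' := by
        rintro _ ⟨a, ha, b, hb, rfl⟩
        change (a * b)⁻¹ ∈ (A : Set G) * B
        rw [h, mul_inv_rev]
        exact Set.mul_mem_mul (B.inv_mem hb) (A.inv_mem ha) }
  have hA : A ≤ K := fun a ha => ⟨a, ha, 1, B.one_mem, mul_one a⟩
  have hB : B ≤ K := fun b hb => ⟨1, A.one_mem, b, hb, one_mul b⟩
  exact sup_le hA hB

/-- If `C = B * A` as sets, then `|C : A| = |B : A ∩ B|`. -/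
theorem Subgroup.relIndex_eq_of_subset_mul {A B C : Subgroup G} (hBC : B ≤ C)
    (h : (C : Set G) ⊆ (B : Set G) * (A : Set G)) : A.relIndex C = A.relIndex B := by
  refine (Nat.card_congr (Equiv.ofBijective (quotientSubgroupOfEmbeddingOfLE A hBC)
    ⟨(quotientSubgroupOfEmbeddingOfLE A hBC).injective, ?_⟩)).symm
  intro q
  obtain ⟨⟨c, hc⟩, rfl⟩ := QuotientGroup.mk_surjective q
  obtain ⟨b, hb, a, ha, rfl⟩ := h hc
  refine ⟨QuotientGroup.mk ⟨b, hb⟩, ?_⟩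
  rw [quotientSubgroupOfEmbeddingOfLE_apply_mk, QuotientGroup.eq, mem_subgroupOf]
  simpa using ha

theorem Subgroup.mul_mem_iff_of_relIndex_eq_two {A C : Subgroup G} (h : A.relIndex C = 2)
    {x y : G} (hx : x ∈ C) (hy : y ∈ C) : x * y ∈ A ↔ (x ∈ A ↔ y ∈ A) := by
  have := mul_mem_iff_of_index_two (H := A.subgroupOf C) h (a := ⟨x, hx⟩) (b := ⟨y, hy⟩)
  simpa [mem_subgroupOf] using this

/-- If `A` and `B` are subgroups of index two in `C`, then the elements of `C` lying in
both or in neither of them form a subgroup. -/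
def Subgroup.iffOfRelIndexTwo {A B C : Subgroup G} (hA : A.relIndex C = 2)
    (hB : B.relIndex C = 2) : Subgroup G where
  carrier := {g | g ∈ C ∧ (g ∈ A ↔ g ∈ B)}
  one_mem' := ⟨C.one_mem, by simp⟩
  mul_mem' := by
    rintro x y ⟨hx, hx'⟩ ⟨hy, hy'⟩
    refine ⟨C.mul_mem hx hy, ?_⟩
    rw [mul_mem_iff_of_relIndex_eq_two hA hx hy, mul_mem_iff_of_relIndex_eq_two hB hx hy, hx', hy']
  inv_mem' := by
    rintro x ⟨hx, hx'⟩
    exact ⟨C.inv_mem hx, by simpa using hx'⟩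

end Products

section BooleanInterval

variable {G : Type*} [Group G] {H : Subgroup G} {ℓ : ℕ} (e : Set.Ici H ≃o Finset (Fin ℓ))

theorem coe_symm_empty : (e.symm ∅).1 = H := by
  refine le_antisymm ?_ (e.symm ∅).2
  have h : e.symm ∅ ≤ ⟨H, le_refl H⟩ := by
    rw [OrderIso.symm_apply_le]; exact Finset.empty_subset _
  exact h

theorem coe_symm_univ : (e.symm Finset.univ).1 = ⊤ := by
  refine le_antisymm le_top ?_
  have h : (⟨⊤, Set.mem_Ici.mpr le_top⟩ : Set.Ici H) ≤ e.symm Finset.univ := by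
    rw [OrderIso.le_symm_apply]; exact Finset.subset_univ _
  exact h

theorem coe_symm_inter (I J : Finset (Fin ℓ)) :
    (e.symm (I ∩ J)).1 = (e.symm I).1 ⊓ (e.symm J).1 :=
  congrArg Subtype.val (e.symm.map_inf I J)

theorem coe_symm_union (I J : Finset (Fin ℓ)) :
    (e.symm (I ∪ J)).1 = (e.symm I).1 ⊔ (e.symm J).1 :=
  congrArg Subtype.val (e.symm.map_sup I J)

theorem coe_symm_mono {I J : Finset (Fin ℓ)} (h : I ⊆ J) : (e.symm I).1 ≤ (e.symm J).1 :=
  e.symm.monotone h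

theorem sup_coe_symm_singleton (I : Finset (Fin ℓ)) :
    (I.sup fun i => (e.symm {i}).1) ⊔ H = (e.symm I).1 := by
  induction I using Finset.induction_on with
  | empty => simp [coe_symm_empty]
  | insert i I _ ih =>
    rw [Finset.sup_insert, sup_assoc, ih, ← coe_symm_union, Finset.insert_eq]

theorem not_coe_symm_singleton_le (i : Fin ℓ) : ¬ (e.symm {i}).1 ≤ H := by
  intro h
  have h' : e.symm {i} ≤ e.symm ∅ := by
    change (e.symm {i}).1 ≤ (e.symm ∅).1
    rwa [coe_symm_empty]
  simpa using e.symm.le_iff_le.mp h'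

variable (hgc : ∀ I : Finset (Fin ℓ),
      (((e.symm I).1 : Set G) * ((e.symm Iᶜ).1 : Set G)) =
        (((e.symm Iᶜ).1 : Set G) * ((e.symm I).1 : Set G)))
include hgc

theorem relIndex_coe_symm_union {I J : Finset (Fin ℓ)} (hIJ : Disjoint I J) :
    (e.symm I).1.relIndex (e.symm (I ∪ J)).1 = H.relIndex (e.symm J).1 := by
  rw [Subgroup.relIndex_eq_of_subset_mul (coe_symm_mono e Finset.subset_union_right),
    ← Subgroup.inf_relIndex_right, ← coe_symm_inter, Finset.disjoint_iff_inter_eq_empty.mp hIJ,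
    coe_symm_empty]
  intro c hc
  have hprod : c ∈ ((e.symm Iᶜ).1 : Set G) * ((e.symm I).1 : Set G) := by
    apply Subgroup.coe_sup_subset_mul_of_mul_comm (hgc I).symm
    rw [← coe_symm_union, Finset.union_comm, Finset.union_compl, coe_symm_univ]
    exact Set.mem_univ c
  obtain ⟨b, hb, a, ha, rfl⟩ := hprod
  refine ⟨b, ?_, a, ha, rfl⟩
  have hbU : b ∈ (e.symm (I ∪ J)).1 :=
    (Subgroup.mul_mem_cancel_right _ (coe_symm_mono e Finset.subset_union_left ha)).mp hc
  have hb' : b ∈ (e.symm ((I ∪ J) ∩ Iᶜ)).1 := by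
    rw [coe_symm_inter]; exact ⟨hbU, hb⟩
  refine coe_symm_mono e ?_ hb'
  intro k hk
  simp only [Finset.mem_inter, Finset.mem_union, Finset.mem_compl] at hk
  tauto

theorem relIndex_coe_symm_eq_prod (I : Finset (Fin ℓ)) :
    H.relIndex (e.symm I).1 = ∏ i ∈ I, H.relIndex (e.symm {i}).1 := by
  induction I using Finset.induction_on with
  | empty => simp [coe_symm_empty]
  | insert i I hi ih =>
    rw [Finset.prod_insert hi, ← ih, Finset.insert_eq,
      ← relIndex_coe_symm_union e hgc (Finset.disjoint_singleton_left.mpr hi)]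
    exact (Subgroup.relIndex_mul_relIndex _ _ _ (e.symm {i}).2
      (coe_symm_mono e Finset.subset_union_left)).symm

theorem index_coe_symm_eq_prod (I : Finset (Fin ℓ)) :
    (e.symm I).1.index = ∏ i ∈ Iᶜ, H.relIndex (e.symm {i}).1 := by
  rw [← relIndex_coe_symm_eq_prod e hgc, ← relIndex_coe_symm_union e hgc disjoint_compl_right,
    Finset.union_compl, coe_symm_univ, Subgroup.relIndex_top_right]

theorem dualEulerTotient_eq_prod :
    dualEulerTotient H e = ∏ i, ((H.relIndex (e.symm {i}).1 : ℤ) - 1) := by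
  simp_rw [sub_eq_neg_add, Finset.prod_add, Finset.powerset_univ, dualEulerTotient,
    sup_coe_symm_singleton, index_coe_symm_eq_prod e hgc, Finset.prod_const, Nat.cast_prod,
    Finset.compl_eq_univ_sdiff]

theorem eq_of_relIndex_coe_symm_singleton_eq_two {i j : Fin ℓ}
    (hi : H.relIndex (e.symm {i}).1 = 2) (hj : H.relIndex (e.symm {j}).1 = 2) : i = j := by
  by_contra hij
  have hd : Disjoint ({i} : Finset (Fin ℓ)) {j} := by simpa using hij
  have hA := (relIndex_coe_symm_union e hgc hd).trans hj
  have hB := (relIndex_coe_symm_union e hgc hd.symm).trans hi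
  rw [Finset.union_comm] at hB
  have hinf : (e.symm {i}).1 ⊓ (e.symm {j}).1 = H := by
    rw [← coe_symm_inter, Finset.disjoint_iff_inter_eq_empty.mp hd, coe_symm_empty]
  let K := Subgroup.iffOfRelIndexTwo hA hB
  have hHi := (e.symm {i}).2
  have hHj := (e.symm {j}).2
  have hiC : (e.symm {i}).1 ≤ (e.symm ({i} ∪ {j})).1 :=
    coe_symm_mono e Finset.subset_union_left
  have hjC : (e.symm {j}).1 ≤ (e.symm ({i} ∪ {j})).1 :=
    coe_symm_mono e Finset.subset_union_right
  have hHK : H ≤ K := fun g hg => ⟨hiC (hHi hg), fun _ => hHj hg, fun _ => hHi hg⟩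
  obtain ⟨L, hL⟩ : ∃ L, (e.symm L).1 = K := ⟨e ⟨K, hHK⟩, by simp⟩
  have hKi : i ∉ L := fun h => not_coe_symm_singleton_le e i fun g hg => by
    have hgK : g ∈ K := hL ▸ coe_symm_mono e (Finset.singleton_subset_iff.mpr h) hg
    rw [← hinf]
    exact ⟨hg, hgK.2.mp hg⟩
  have hKj : j ∉ L := fun h => not_coe_symm_singleton_le e j fun g hg => by
    have hgK : g ∈ K := hL ▸ coe_symm_mono e (Finset.singleton_subset_iff.mpr h) hg
    rw [← hinf]
    exact ⟨hgK.2.mpr hg, hg⟩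
  have hLsub : L ⊆ {i} ∪ {j} := by
    refine e.symm.le_iff_le.mp (?_ : (e.symm L).1 ≤ (e.symm ({i} ∪ {j})).1)
    rw [hL]
    exact fun g hg => hg.1
  have hL0 : L = ∅ := by
    refine Finset.eq_empty_of_forall_notMem fun k hk => ?_
    have := hLsub hk
    simp only [Finset.mem_union, Finset.mem_singleton] at this
    obtain rfl | rfl := this
    · exact hKi hk
    · exact hKj hk
  rw [hL0, coe_symm_empty] at hL
  obtain ⟨x, hx, hxH⟩ := SetLike.not_le_iff_exists.mp (not_coe_symm_singleton_le e i)
  obtain ⟨y, hy, hyH⟩ := SetLike.not_le_iff_exists.mp (not_coe_symm_singleton_le e j)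
  have hxy_i : x * y ∉ (e.symm {i}).1 := fun h =>
    hyH (hinf ▸ ⟨(Subgroup.mul_mem_cancel_left _ hx).mp h, hy⟩)
  have hxy_j : x * y ∉ (e.symm {j}).1 := fun h =>
    hxH (hinf ▸ ⟨hx, (Subgroup.mul_mem_cancel_right _ hy).mp h⟩)
  have hxyK : x * y ∈ K := ⟨mul_mem (hiC hx) (hjC hy), iff_of_false hxy_i hxy_j⟩
  rw [← hL] at hxyK
  exact hxy_i (hHi hxyK)

end BooleanInterval

theorem two_le_relIndex_coe_symm_singleton {G : Type*} [Group G] [Finite G] {H : Subgroup G}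
    {ℓ : ℕ} (e : Set.Ici H ≃o Finset (Fin ℓ)) (i : Fin ℓ) :
    2 ≤ H.relIndex (e.symm {i}).1 := by
  have h0 : H.relIndex (e.symm {i}).1 ≠ 0 := (H.subgroupOf _).index_ne_zero_of_finite
  have h1 : H.relIndex (e.symm {i}).1 ≠ 1 := fun h =>
    not_coe_symm_singleton_le e i (Subgroup.relIndex_eq_one.mp h)
  omega

theorem two_pow_card_sub_one_le_prod_sub_one {ι : Type*} [Fintype ι] [DecidableEq ι] {a : ι → ℕ}
    (ha : ∀ i, 2 ≤ a i) (huniq : ∀ i j, a i = 2 → a j = 2 → i = j) :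
    (2 : ℤ) ^ (Fintype.card ι - 1) ≤ ∏ i, ((a i : ℤ) - 1) := by
  by_cases h : ∃ i, a i = 2
  · obtain ⟨i, hi⟩ := h
    rw [← Finset.mul_prod_erase _ _ (Finset.mem_univ i), hi, ← Finset.card_univ,
      ← Finset.card_erase_of_mem (Finset.mem_univ i), ← Finset.prod_const, Nat.cast_ofNat,
      show (2 : ℤ) - 1 = 1 by norm_num, one_mul]
    refine Finset.prod_le_prod (fun _ _ => by norm_num) fun j hj => ?_
    have h2 := ha j
    have h3 : a j ≠ 2 := fun hj2 => Finset.ne_of_mem_erase hj (huniq j i hj2 hi)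
    omega
  · push Not at h
    refine (pow_le_pow_right₀ (by norm_num) (Nat.sub_le _ 1)).trans ?_
    rw [← Finset.card_univ, ← Finset.prod_const]
    refine Finset.prod_le_prod (fun _ _ => by norm_num) fun j _ => ?_
    have h2 := ha j
    have h3 := h j
    omega

/-- Let `G` be a finite group and `H ≤ G` a subgroup such that the
overgroup lattice `O_G(H)` is Boolean of rank `ℓ` and group-complemented, i.e.
`K·K^∁ = K^∁·K` (as subsets of `G`) for every `K` in the interval (the elements
of the interval are the `e.symm I`, and the lattice complement of `e.symm I` is
`e.symm Iᶜ`). Then `φ̂(H,G) ≥ 2^(ℓ−1)`; in particular `φ̂(H,G) ≠ 0`. -/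
theorem statement3 {G : Type*} [Group G] [Finite G] (H : Subgroup G) {ℓ : ℕ}
    (e : Set.Ici H ≃o Finset (Fin ℓ))
    (hgc : ∀ I : Finset (Fin ℓ),
      (((e.symm I).1 : Set G) * ((e.symm Iᶜ).1 : Set G)) =
        (((e.symm Iᶜ).1 : Set G) * ((e.symm I).1 : Set G))) :
    (2 : ℤ) ^ (ℓ - 1) ≤ dualEulerTotient H e ∧ dualEulerTotient H e ≠ 0 := by
  have hle : (2 : ℤ) ^ (ℓ - 1) ≤ dualEulerTotient H e := by
    rw [dualEulerTotient_eq_prod e hgc]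
    simpa using two_pow_card_sub_one_le_prod_sub_one (two_le_relIndex_coe_symm_singleton e)
      fun _ _ => eq_of_relIndex_coe_symm_singleton_eq_two e hgc
  exact ⟨hle, ((pow_pos (by norm_num) _).trans_le hle).ne'⟩
end

section
/- Let Ω be a finite set, let G be Sym(Ω) or Alt(Ω), and let H ≤ G be a subgroup such that the overgroup lattice O_G(H) is Boolean. If every coatom of O_G(H) acts transitively on Ω, then either H acts transitively on Ω, or there is a subset Γ ⊆ Ω with 2·|Γ| = |Ω| such that the stabilizer in G of the partition {Γ, Ω∖Γ} belongs to O_G(H) (equivalently, H preserves the partition of Ω into the two blocks Γ and Ω∖Γ). -/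
/-- The stabilizer in `Perm Ω` of a partition of `Ω`, given as a setoid `σ`:
the permutations `g` with `x ∼_σ y ↔ g x ∼_σ g y` for all `x, y`. -/
def partStab {Ω : Type*} (σ : Setoid Ω) : Subgroup (Equiv.Perm Ω) where
  carrier := {g | ∀ x y : Ω, σ.r (g x) (g y) ↔ σ.r x y}
  one_mem' := by intro x y; simp
  mul_mem' := by
    intro g h hg hh x y
    simpa [Equiv.Perm.mul_apply] using (hg (h x) (h y)).trans (hh x y)
  inv_mem' := by
    intro g hg x y
    simpa using (hg (g⁻¹ x) (g⁻¹ y)).symm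

/-- The setwise stabilizer in `Perm Ω` of a subset `Γ ⊆ Ω`. -/
def setStab {Ω : Type*} (Γ : Set Ω) : Subgroup (Equiv.Perm Ω) where
  carrier := {g | ∀ x : Ω, g x ∈ Γ ↔ x ∈ Γ}
  one_mem' := by intro x; simp
  mul_mem' := by
    intro g h hg hh x
    simpa [Equiv.Perm.mul_apply] using (hg (h x)).trans (hh x)
  inv_mem' := by
    intro g hg x
    simpa using (hg (g⁻¹ x)).symm

/-- A partition (setoid) is regular (uniform) if all its blocks have the same size. -/
def IsUniformSetoid {Ω : Type*} (σ : Setoid Ω) : Prop :=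
  ∀ x y : Ω, Nat.card {z | σ.r x z} = Nat.card {z | σ.r y z}

/-- A subgroup of `Perm Ω` is transitive if it acts transitively on `Ω`. -/
def SubgroupTransitive {Ω : Type*} (K : Subgroup (Equiv.Perm Ω)) : Prop :=
  ∀ x y : Ω, ∃ g ∈ K, g x = y

/-- A subgroup of `Perm Ω` is primitive if it is transitive and the only partitions
of `Ω` it leaves invariant are the two trivial ones. -/
def SubgroupPrimitive {Ω : Type*} (K : Subgroup (Equiv.Perm Ω)) : Prop :=
  SubgroupTransitive K ∧ ∀ σ : Setoid Ω, K ≤ partStab σ → σ = ⊥ ∨ σ = ⊤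

/-- A subgroup of `Perm Ω` is regular if it is transitive with trivial point stabilizers. -/
def SubgroupRegular {Ω : Type*} (V : Subgroup (Equiv.Perm Ω)) : Prop :=
  SubgroupTransitive V ∧ ∀ g ∈ V, (∃ x : Ω, g x = x) → g = 1

/-- A subgroup is elementary abelian if it is abelian and all its non-identity
elements have order `p`, for a fixed prime `p`. -/
def IsElementaryAbelian {G : Type*} [Group G] (V : Subgroup G) : Prop :=
  (∀ a ∈ V, ∀ b ∈ V, a * b = b * a) ∧
    ∃ p : ℕ, p.Prime ∧ ∀ g ∈ V, g ≠ 1 → orderOf g = p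

/-- `K` is a coatom (i.e. a maximal element below the top) of the interval `[H, G]`
in the subgroup lattice. -/
def IsCoatomOfInterval {Γ : Type*} [Group Γ] (G H K : Subgroup Γ) : Prop :=
  H ≤ K ∧ K < G ∧ ∀ L : Subgroup Γ, K < L → L ≤ G → L = G

/-- The image of a partition (setoid) of `Ω` under a permutation `g`. -/
def permSetoid {Ω : Type*} (g : Equiv.Perm Ω) (σ : Setoid Ω) : Setoid Ω where
  r x y := σ.r (g⁻¹ x) (g⁻¹ y)
  iseqv := ⟨fun _ => σ.iseqv.refl _, fun h => σ.iseqv.symm h, fun h₁ h₂ => σ.iseqv.trans h₁ h₂⟩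

theorem permSetoid_one {Ω : Type*} (σ : Setoid Ω) : permSetoid 1 σ = σ := by
  apply Setoid.ext
  intro x y
  show σ.r ((1 : Equiv.Perm Ω)⁻¹ x) ((1 : Equiv.Perm Ω)⁻¹ y) ↔ σ.r x y
  simp

theorem permSetoid_mul {Ω : Type*} (g h : Equiv.Perm Ω) (σ : Setoid Ω) :
    permSetoid (g * h) σ = permSetoid g (permSetoid h σ) := by
  apply Setoid.ext
  intro x y
  show σ.r ((g * h)⁻¹ x) ((g * h)⁻¹ y) ↔ σ.r (h⁻¹ (g⁻¹ x)) (h⁻¹ (g⁻¹ y))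
  simp [mul_inv_rev, Equiv.Perm.mul_apply]

/-- The stabilizer in `Perm Ω` of a (product) structure given by a finite set `F`
of partitions of `Ω`: the permutations mapping each member of `F` to a member of `F`. -/
def prodStab {Ω : Type*} (F : Finset (Setoid Ω)) : Subgroup (Equiv.Perm Ω) where
  carrier := {g | ∀ σ ∈ F, permSetoid g σ ∈ F}
  one_mem' := by
    intro σ hσ
    rw [permSetoid_one]
    exact hσ
  mul_mem' := by
    intro g h hg hh σ hσ
    rw [permSetoid_mul]
    exact hg _ (hh σ hσ)
  inv_mem' := by
    classical
    intro g hg σ hσ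
    have hinj : Function.Injective (fun τ : Setoid Ω => permSetoid g τ) := by
      intro a b hab
      have h2 := congrArg (permSetoid g⁻¹) hab
      simpa [← permSetoid_mul, permSetoid_one] using h2
    have himg : F.image (fun τ => permSetoid g τ) = F := by
      apply Finset.eq_of_subset_of_card_le
      · intro τ hτ
        obtain ⟨τ', hτ', rfl⟩ := Finset.mem_image.1 hτ
        exact hg τ' hτ'
      · rw [Finset.card_image_of_injective _ hinj]
    have hmem : σ ∈ F.image (fun τ => permSetoid g τ) := by rw [himg]; exact hσ
    obtain ⟨τ, hτ, hτσ⟩ := Finset.mem_image.1 hmem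
    have hkey : permSetoid g⁻¹ σ = τ := by
      rw [← hτσ, ← permSetoid_mul]
      simp [permSetoid_one]
    rw [hkey]
    exact hτ

/-- A regular `(m, k)`-product structure on `Ω`: a set `F` of `k` partitions of `Ω`,
each with exactly `m` blocks, all of size `m^(k-1)`, which together separate the
points of `Ω`; here `m ≥ 5`, `k ≥ 2` and `|Ω| = m^k`. -/
structure IsProductStructure {Ω : Type*} (m k : ℕ) (F : Finset (Setoid Ω)) : Prop where
  five_le : 5 ≤ m
  two_le : 2 ≤ k
  card_omega : Nat.card Ω = m ^ k
  card_F : F.card = k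
  nblocks : ∀ σ ∈ F, Nat.card (Quotient σ) = m
  block_size : ∀ σ ∈ F, ∀ x : Ω, Nat.card {z | σ.r x z} = m ^ (k - 1)
  separating : ∀ x y : Ω, (∀ σ ∈ F, σ.r x y) → x = y

/-- The partial order on regular product structures: `F ≤ F'` when `F'` is obtained
by splitting each partition of `F` into `s` partitions of `F'`, each refined by it.
Formally there is `s ≥ 1` and a map `f` sending each member of `F'` to the member of
`F` refining it, whose fibers over members of `F` all have `s` elements. -/
def ProdStructLE {Ω : Type*} (F F' : Finset (Setoid Ω)) : Prop :=
  ∃ s : ℕ, 1 ≤ s ∧ F'.card = F.card * s ∧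
    ∃ f : Setoid Ω → Setoid Ω,
      (∀ τ ∈ F', f τ ∈ F ∧ f τ ≤ τ) ∧
      ∀ σ ∈ F, Nat.card {τ : Setoid Ω // τ ∈ F' ∧ f τ = σ} = s

/-- Strict order on regular product structures. -/
def ProdStructLT {Ω : Type*} (F F' : Finset (Setoid Ω)) : Prop :=
  ProdStructLE F F' ∧ F ≠ F'

/-- The partition of `Ω` into the two blocks `Γ` and `Ω ∖ Γ`. -/
def twoBlockSetoid {Ω : Type*} (Γ : Set Ω) : Setoid Ω where
  r x y := (x ∈ Γ ↔ y ∈ Γ)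
  iseqv := ⟨fun _ => Iff.rfl, Iff.symm, Iff.trans⟩

open scoped Pointwise in
theorem mem_setStab_iff_mem_stabilizer {Ω : Type*} {Γ : Set Ω} {g : Equiv.Perm Ω} :
    g ∈ setStab Γ ↔ g ∈ MulAction.stabilizer (Equiv.Perm Ω) Γ := by
  rw [MulAction.mem_stabilizer_set]
  rfl

theorem setStab_le_partStab_twoBlockSetoid {Ω : Type*} (Γ : Set Ω) :
    setStab Γ ≤ partStab (twoBlockSetoid Γ) :=
  fun _ hg x y => iff_congr (hg x) (hg y)

/-- A subgroup `S` whose intersection with `G` is a maximal subgroup of `G` yields a coatom of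
every interval `[H, G]` with `H ≤ S`. -/
theorem isCoatomOfInterval_inf {Γ : Type*} [Group Γ] {G H S : Subgroup Γ} (hHG : H ≤ G)
    (hHS : H ≤ S) (hS : IsCoatom (S.subgroupOf G)) : IsCoatomOfInterval G H (S ⊓ G) := by
  refine ⟨le_inf hHS hHG, lt_of_le_of_ne inf_le_right fun h => hS.1 ?_, fun L hL hLG => ?_⟩
  · exact Subgroup.subgroupOf_eq_top.2 (inf_eq_right.1 h)
  · refine hLG.antisymm (Subgroup.subgroupOf_eq_top.1 (hS.2 _ ?_))
    refine lt_of_le_not_ge (fun g hg => hL.le ⟨hg, g.2⟩) fun h => hL.not_ge fun g hg => ?_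
    exact ⟨@h ⟨g, hLG hg⟩ hg, hLG hg⟩

open scoped Pointwise in
theorem isCoatom_setStab_subgroupOf {Ω : Type*} [Fintype Ω] [DecidableEq Ω]
    {G : Subgroup (Equiv.Perm Ω)} (hG : G = ⊤ ∨ G = alternatingGroup Ω) {Γ : Set Ω}
    (h0 : Γ.Nonempty) (h1 : Γᶜ.Nonempty) (hΓ : Nat.card Ω ≠ 2 * Γ.ncard) :
    IsCoatom ((setStab Γ).subgroupOf G) := by
  rcases hG with rfl | rfl
  · have h := Equiv.Perm.isCoatom_stabilizer h0 h1 hΓ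
    have hS : setStab Γ = MulAction.stabilizer (Equiv.Perm Ω) Γ :=
      Subgroup.ext fun _ => mem_setStab_iff_mem_stabilizer
    rw [hS]
    exact (OrderIso.isCoatom_iff (Subgroup.topEquiv (G := Equiv.Perm Ω)).comapSubgroup _).2 h
  · have hS : (setStab Γ).subgroupOf (alternatingGroup Ω) =
        MulAction.stabilizer (alternatingGroup Ω) Γ :=
      Subgroup.ext fun _ => mem_setStab_iff_mem_stabilizer
    rw [hS]
    exact alternatingGroup.isCoatom_stabilizer h0 h1 hΓ

/-- Let `Ω` be a finite set, `G` be `Sym(Ω)` or `Alt(Ω)`, and `H ≤ G`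
with the overgroup lattice `O_G(H)` Boolean. If every coatom of `O_G(H)` is transitive
on `Ω`, then either `H` is transitive on `Ω`, or there is `Γ ⊆ Ω` with `2|Γ| = |Ω|`
such that the stabilizer in `G` of the partition `{Γ, Ω ∖ Γ}` belongs to `O_G(H)`. -/
theorem statement9 {Ω : Type*} [Fintype Ω] [DecidableEq Ω]
    (G H : Subgroup (Equiv.Perm Ω))
    (hG : G = ⊤ ∨ G = alternatingGroup Ω) (hHG : H ≤ G)
    {ℓ : ℕ} (e : Set.Icc H G ≃o Finset (Fin ℓ))
    (hcoatoms : ∀ K : Subgroup (Equiv.Perm Ω),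
      IsCoatomOfInterval G H K → SubgroupTransitive K) :
    SubgroupTransitive H ∨
      ∃ Γ : Set Ω, 2 * Nat.card Γ = Nat.card Ω ∧
        H ≤ partStab (twoBlockSetoid Γ) ⊓ G := by
  refine or_iff_not_imp_left.2 fun hH => ?_
  obtain ⟨x, y, hxy⟩ : ∃ x y : Ω, ∀ g ∈ H, g x ≠ y := by
    simpa [SubgroupTransitive] using hH
  let Γ : Set Ω := MulAction.orbit H x
  have hx : x ∈ Γ := MulAction.mem_orbit_self x
  have hy : y ∉ Γ := by
    rintro ⟨g, hg⟩
    exact hxy g g.2 hg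
  have hHΓ : H ≤ setStab Γ := fun g hg z =>
    ⟨fun hz => by
      simpa [Subgroup.smul_def] using MulAction.mem_orbit_of_mem_orbit (⟨g, hg⟩ : H)⁻¹ hz,
      MulAction.mem_orbit_of_mem_orbit (⟨g, hg⟩ : H)⟩
  by_cases hΓ : Nat.card Ω = 2 * Γ.ncard
  · exact ⟨Γ, hΓ.symm, le_inf (hHΓ.trans (setStab_le_partStab_twoBlockSetoid Γ)) hHG⟩
  · obtain ⟨g, hg, rfl⟩ := hcoatoms _ (isCoatomOfInterval_inf hHG hHΓ
      (isCoatom_setStab_subgroupOf hG ⟨x, hx⟩ ⟨y, hy⟩ hΓ)) x y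
    exact absurd ((hg.1 x).2 hx) hy
end

section
/- Let Δ be a finite set with |Δ| ≥ 2 and let Ω be the set of 2-element subsets of Δ. Consider the natural group homomorphism from Sym(Δ) to Sym(Ω), where a permutation g of Δ sends a pair {x,y} to {g·x, g·y}. Then the image of this homomorphism is contained in the alternating group Alt(Ω) if and only if |Δ| is even. -/
/-- The permutation induced on the set of 2-element subsets of `Δ` by a
permutation `g` of `Δ`. -/
def pairMap {Δ : Type*} [DecidableEq Δ] (g : Equiv.Perm Δ) :
    Equiv.Perm {s : Finset Δ // s.card = 2} where
  toFun s := ⟨s.1.image g, by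
    rw [Finset.card_image_of_injective _ g.injective]; exact s.2⟩
  invFun s := ⟨s.1.image g.symm, by
    rw [Finset.card_image_of_injective _ g.symm.injective]; exact s.2⟩
  left_inv s := by
    apply Subtype.ext
    simp [Finset.image_image, Function.comp_def]
  right_inv s := by
    apply Subtype.ext
    simp [Finset.image_image, Function.comp_def]

/-- The natural homomorphism `Sym(Δ) → Sym(Ω)` where `Ω` is the set of 2-element
subsets of `Δ`, sending `g` to the permutation `{x, y} ↦ {g x, g y}`. -/
def pairHom (Δ : Type*) [DecidableEq Δ] :
    Equiv.Perm Δ →* Equiv.Perm {s : Finset Δ // s.card = 2} where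
  toFun := pairMap
  map_one' := by
    apply Equiv.ext
    intro s
    apply Subtype.ext
    simp [pairMap]
  map_mul' g h := by
    apply Equiv.ext
    intro s
    apply Subtype.ext
    simp [pairMap, Finset.image_image, Function.comp_def, Equiv.Perm.mul_apply]

theorem pairHom_apply_coe {Δ : Type*} [DecidableEq Δ] (g : Equiv.Perm Δ)
    (s : {s : Finset Δ // s.card = 2}) : (pairHom Δ g s : Finset Δ) = s.1.image g := rfl

/-- The pairs moved by the transposition of `a` and `b` are those meeting `{a, b}` in exactly one
point. -/
theorem support_pairHom_swap {Δ : Type*} [Fintype Δ] [DecidableEq Δ] {a b : Δ} (hab : a ≠ b) :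
    (pairHom Δ (Equiv.swap a b)).support.map (Function.Embedding.subtype _) =
      (({a, b} : Finset Δ) ×ˢ ({a, b} : Finset Δ)ᶜ).image
        fun p ↦ ({p.1, p.2} : Finset Δ) := by
  ext s
  simp only [Finset.mem_map, Equiv.Perm.mem_support, Function.Embedding.subtype_apply,
    Finset.mem_image, Finset.mem_product, Finset.mem_compl, Prod.exists, ne_eq, Subtype.ext_iff,
    pairHom_apply_coe, Subtype.exists, exists_and_right, exists_eq_right]
  constructor
  · rintro ⟨hs, hne⟩
    obtain ⟨x, y, hxy, rfl⟩ := Finset.card_eq_two.mp hs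
    by_cases hx : x ∈ ({a, b} : Finset Δ)
    · by_cases hy : y ∈ ({a, b} : Finset Δ)
      · refine absurd ?_ hne
        simp only [Finset.mem_insert, Finset.mem_singleton] at hx hy
        rcases hx with rfl | rfl <;> rcases hy with rfl | rfl <;>
          simp_all [Finset.image_insert, Finset.pair_comm]
      · exact ⟨x, y, ⟨hx, hy⟩, rfl⟩
    · by_cases hy : y ∈ ({a, b} : Finset Δ)
      · exact ⟨y, x, ⟨hy, hx⟩, Finset.pair_comm _ _⟩
      · refine absurd ?_ hne
        simp only [Finset.mem_insert, Finset.mem_singleton, not_or] at hx hy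
        simp [Finset.image_insert, Equiv.swap_apply_of_ne_of_ne, hx, hy]
  · rintro ⟨x, c, ⟨hx, hc⟩, rfl⟩
    simp only [Finset.mem_insert, Finset.mem_singleton, not_or] at hx hc
    have hxc : x ≠ c := by grind
    refine ⟨Finset.card_pair hxc, fun h ↦ ?_⟩
    have hmem : Equiv.swap a b x ∈ ({x, c} : Finset Δ) := by
      rw [← h]
      exact Finset.mem_image_of_mem _ (Finset.mem_insert_self _ _)
    rcases hx with rfl | rfl <;> simp at hmem <;> grind

theorem card_support_pairHom_swap {Δ : Type*} [Fintype Δ] [DecidableEq Δ] {a b : Δ}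
    (hab : a ≠ b) :
    (pairHom Δ (Equiv.swap a b)).support.card = 2 * (Fintype.card Δ - 2) := by
  rw [← Finset.card_map (Function.Embedding.subtype _), support_pairHom_swap hab,
    Finset.card_image_of_injOn, Finset.card_product, Finset.card_compl, Finset.card_pair hab]
  rintro ⟨x, c⟩ hx ⟨y, d⟩ hy h
  simp only [Finset.coe_product, Set.mem_prod, Finset.mem_coe, Finset.mem_compl] at hx hy
  replace h : ({x, c} : Finset Δ) = {y, d} := h
  have hxm : x ∈ ({y, d} : Finset Δ) := h ▸ Finset.mem_insert_self _ _
  have hcm : c ∈ ({y, d} : Finset Δ) := by simp [← h]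
  rw [Finset.mem_insert, Finset.mem_singleton] at hxm hcm
  have hxy : x = y := hxm.resolve_right fun e ↦ hy.2 (e ▸ hx.1)
  have hcd : c = d := hcm.resolve_left fun e ↦ hx.2 (e ▸ hy.1)
  rw [hxy, hcd]

theorem sign_pairHom_swap {Δ : Type*} [Fintype Δ] [DecidableEq Δ] {a b : Δ} (hab : a ≠ b) :
    Equiv.Perm.sign (pairHom Δ (Equiv.swap a b)) = (-1) ^ (Fintype.card Δ - 2) := by
  have hsq : pairHom Δ (Equiv.swap a b) ^ 2 = 1 := by
    rw [← map_pow, sq, Equiv.swap_mul_self, map_one]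
  rw [Equiv.Perm.sign_of_pow_two_eq_one hsq, Equiv.Perm.card_fixedPoints,
    Nat.sub_sub_self (Equiv.Perm.sum_cycleType_le _), Equiv.Perm.sum_cycleType, card_support_pairHom_swap hab,
    Nat.mul_div_cancel_left _ two_pos]

/-- Let `Δ` be a finite set with `|Δ| ≥ 2` and let `Ω` be the set of
2-element subsets of `Δ`. The image of the natural homomorphism `Sym(Δ) → Sym(Ω)` is
contained in the alternating group `Alt(Ω)` if and only if `|Δ|` is even. -/
theorem statement11 {Δ : Type*} [Fintype Δ] [DecidableEq Δ] (h2 : 2 ≤ Nat.card Δ) :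
    (∀ g : Equiv.Perm Δ, pairHom Δ g ∈ alternatingGroup {s : Finset Δ // s.card = 2}) ↔
      Even (Nat.card Δ) := by
  rw [Nat.card_eq_fintype_card] at h2 ⊢
  simp only [Equiv.Perm.mem_alternatingGroup]
  constructor
  · intro h
    obtain ⟨a, b, hab⟩ := Fintype.exists_pair_of_one_lt_card h2
    have h1 := h (Equiv.swap a b)
    rw [sign_pairHom_swap hab, neg_one_pow_eq_one_iff_even (by decide)] at h1
    exact (Nat.even_sub h2).mp h1 |>.mpr even_two
  · intro he g
    induction g using Equiv.Perm.swap_induction_on with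
    | one => simp
    | swap_mul f x y hxy ih =>
      rw [map_mul, map_mul, ih, sign_pairHom_swap hxy, mul_one]
      exact ((Nat.even_sub h2).mpr (iff_of_true he even_two)).neg_one_pow
end

section
/- Let G be a finite group and H ≤ G a subgroup such that the overgroup lattice O_G(H) is Boolean of rank ℓ with ℓ ∈ {1, 2}. Then the dual Euler totient satisfies φ̂(H,G) ≥ 2^{ℓ−1}. -/
namespace Subgroup

variable {G : Type*} [Group G]

/-- In a group, two elements with trivial squares whose product generates a subgroup containing
the first one satisfy `x = 1` or `y = 1`. -/
theorem eq_one_or_eq_one_of_mem_zpowers_mul {x y : G} (hx : x * x = 1) (hy : y * y = 1)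
    (h : x ∈ zpowers (x * y)) : x = 1 ∨ y = 1 := by
  obtain ⟨k, hk⟩ := mem_zpowers_iff.1 h
  have hc : Commute x (x * y) := by
    have := (Commute.refl (x * y)).zpow_left k
    rwa [hk] at this
  have hxy : x * y = y * x := by
    have h1 : x * (x * y) = x * y * x := hc
    rw [mul_assoc] at h1
    exact mul_left_cancel h1
  have hsq : (x * y) * (x * y) = 1 := by
    calc (x * y) * (x * y) = x * y * (y * x) := by rw [← hxy]
      _ = x * (y * y) * x := by simp only [mul_assoc]
      _ = 1 := by rw [hy, mul_one, hx]
  have hsq' : (x * y) ^ (2 : ℤ) = 1 := by rw [zpow_two, hsq]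
  rcases Int.even_or_odd' k with ⟨m, rfl | rfl⟩
  · left
    rw [← hk, zpow_mul, hsq', one_zpow]
  · right
    rw [zpow_add, zpow_mul, hsq', one_zpow, one_mul, zpow_one] at hk
    exact mul_eq_left.1 hk

theorem le_normalizer_of_relIndex_eq_two {H A : Subgroup G} (hHA : H ≤ A)
    (h : H.relIndex A = 2) : A ≤ normalizer (H : Set G) :=
  (normal_subgroupOf_iff_le_normalizer hHA).1 (normal_of_index_eq_two h)

theorem mul_self_mem_of_relIndex_eq_two {H A : Subgroup G}
    (h : H.relIndex A = 2) {x : G} (hx : x ∈ A) : x * x ∈ H :=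
  mul_self_mem_of_index_two (H := H.subgroupOf A) h ⟨x, hx⟩

/-- If `A` and `B` are the atoms of a Boolean interval `[H, G]` of rank two, then `H` cannot have
index two in both. -/
theorem not_relIndex_eq_two_and_relIndex_eq_two {H A B : Subgroup G} (hA : H < A) (hB : H < B)
    (hinf : A ⊓ B = H) (hsup : A ⊔ B = ⊤)
    (hK : ∀ K : Subgroup G, H ≤ K → K = H ∨ K = A ∨ K = B ∨ K = ⊤) :
    ¬ (H.relIndex A = 2 ∧ H.relIndex B = 2) := by
  rintro ⟨h2A, h2B⟩
  have hN : H.Normal := by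
    rw [← normalizer_eq_top_iff, eq_top_iff, ← hsup]
    exact sup_le (le_normalizer_of_relIndex_eq_two hA.le h2A)
      (le_normalizer_of_relIndex_eq_two hB.le h2B)
  obtain ⟨x, hxA, hxH⟩ := SetLike.exists_of_lt hA
  obtain ⟨y, hyB, hyH⟩ := SetLike.exists_of_lt hB
  have hxB : x ∉ B := fun h => hxH (hinf ▸ ⟨hxA, h⟩)
  have hyA : y ∉ A := fun h => hyH (hinf ▸ ⟨h, hyB⟩)
  let K : Subgroup G := (zpowers ((x * y : G) : G ⧸ H)).comap (QuotientGroup.mk' H)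
  have hHK : H ≤ K := fun h hh => by
    have : QuotientGroup.mk' H h = 1 := (QuotientGroup.eq_one_iff h).2 hh
    rw [mem_comap, this]
    exact one_mem _
  have hxyK : x * y ∈ K := mem_zpowers _
  have hA' : x * y ∉ A := fun h => hyA ((A.mul_mem_cancel_left hxA).1 h)
  have hB' : x * y ∉ B := fun h => hxB ((B.mul_mem_cancel_right hyB).1 h)
  rcases hK K hHK with h | h | h | h
  · exact hA' (hA.le (h ▸ hxyK))
  · exact hA' (h ▸ hxyK)
  · exact hB' (h ▸ hxyK)
  · have hx : ((x : G) : G ⧸ H) ∈ zpowers ((x : G ⧸ H) * (y : G ⧸ H)) := by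
      have : x ∈ K := h ▸ mem_top x
      exact this
    rcases eq_one_or_eq_one_of_mem_zpowers_mul
      ((QuotientGroup.eq_one_iff _).2 (mul_self_mem_of_relIndex_eq_two h2A hxA))
      ((QuotientGroup.eq_one_iff _).2 (mul_self_mem_of_relIndex_eq_two h2B hyB)) hx with h1 | h1
    · exact hxH ((QuotientGroup.eq_one_iff _).1 h1)
    · exact hyH ((QuotientGroup.eq_one_iff _).1 h1)

theorem two_le_relIndex_of_lt [Finite G] {H A : Subgroup G} (h : H < A) : 2 ≤ H.relIndex A := by
  have h0 : H.relIndex A ≠ 0 := index_ne_zero_of_finite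
  have h1 : H.relIndex A ≠ 1 := fun h1 => h.not_ge (relIndex_eq_one.1 h1)
  omega

/-- If `A` and `B` are the atoms of a Boolean interval `[H, G]` of rank two, then
`|G : A| + |G : B| < |G : H|`. -/
theorem index_add_index_lt_index [Finite G] {H A B : Subgroup G} (hA : H < A) (hB : H < B)
    (hinf : A ⊓ B = H) (hsup : A ⊔ B = ⊤)
    (hK : ∀ K : Subgroup G, H ≤ K → K = H ∨ K = A ∨ K = B ∨ K = ⊤) :
    A.index + B.index < H.index := by
  have h := not_relIndex_eq_two_and_relIndex_eq_two hA hB hinf hsup hK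
  have ha := two_le_relIndex_of_lt hA
  have hb := two_le_relIndex_of_lt hB
  have hc := relIndex_mul_index hA.le
  have hd := relIndex_mul_index hB.le
  have hn : 0 < H.index := Nat.pos_of_ne_zero index_ne_zero_of_finite
  have hca := Nat.mul_le_mul_right A.index ha
  have hdb := Nat.mul_le_mul_right B.index hb
  by_cases h2 : H.relIndex A = 2
  · have hb' : 3 ≤ H.relIndex B := by omega
    have := Nat.mul_le_mul_right B.index hb'
    omega
  · have ha' : 3 ≤ H.relIndex A := by omega
    have := Nat.mul_le_mul_right A.index ha'
    omega

end Subgroup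

theorem dualEulerTotient_rank_one {G : Type*} [Group G] (H : Subgroup G)
    (e : Set.Ici H ≃o Finset (Fin 1)) : dualEulerTotient H e = H.index - 1 := by
  have htop : ((e.symm {0}).1 : Subgroup G) = ⊤ := by
    have : e.symm {0} = ⊤ := by rw [← e.symm.map_top]; rfl
    rw [this]; rfl
  have huniv : (Finset.univ : Finset (Finset (Fin 1))) = {∅, {0}} := by decide
  rw [dualEulerTotient, huniv, Finset.sum_pair (by decide)]
  simp [htop]
  ring

theorem dualEulerTotient_rank_two {G : Type*} [Group G] (H : Subgroup G)
    (e : Set.Ici H ≃o Finset (Fin 2)) :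
    dualEulerTotient H e =
      H.index - (e.symm {0}).1.index - (e.symm {1}).1.index + 1 := by
  have hsup : (e.symm {0}).1 ⊔ (e.symm {1}).1 = ⊤ := by
    have h : e.symm {0} ⊔ e.symm {1} = ⊤ := by
      rw [← e.symm.map_sup, ← e.symm.map_top]; rfl
    exact congrArg Subtype.val h
  have huniv : (Finset.univ : Finset (Finset (Fin 2))) = {∅, {0}, {1}, {0, 1}} := by decide
  have h0 : (e.symm {0}).1 ⊔ H = (e.symm {0}).1 := sup_eq_left.2 (e.symm {0}).2
  have h1 : (e.symm {1}).1 ⊔ H = (e.symm {1}).1 := sup_eq_left.2 (e.symm {1}).2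
  rw [dualEulerTotient, huniv, Finset.sum_insert (by decide), Finset.sum_insert (by decide),
    Finset.sum_pair (by decide)]
  simp [h0, h1, hsup]
  ring

/-- If `G` is a finite group and `H ≤ G` is a subgroup such that the
overgroup lattice `O_G(H)` is Boolean of rank `ℓ ∈ {1, 2}`, then `φ̂(H,G) ≥ 2^(ℓ−1)`. -/
theorem statement15 {G : Type*} [Group G] [Finite G] (H : Subgroup G) {ℓ : ℕ}
    (hℓ : ℓ = 1 ∨ ℓ = 2) (e : Set.Ici H ≃o Finset (Fin ℓ)) :
    (2 : ℤ) ^ (ℓ - 1) ≤ dualEulerTotient H e := by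
  rcases hℓ with rfl | rfl
  · have hlt : H < ⊤ := by
      have h : e.symm ⊥ < e.symm ⊤ := e.symm.strictMono (by decide)
      exact lt_of_le_of_lt (e.symm ⊥).2 (lt_of_lt_of_le h le_top)
    have h := Subgroup.two_le_relIndex_of_lt hlt
    rw [Subgroup.relIndex_top_right] at h
    rw [dualEulerTotient_rank_one]
    norm_num
    omega
  · have hbot : (e.symm ∅).1 = H := congrArg Subtype.val e.symm.map_bot
    have htop : (e.symm {0, 1}).1 = ⊤ := congrArg Subtype.val e.symm.map_top
    have hlt (i : Fin 2) : H < (e.symm {i}).1 := by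
      have h : e.symm ∅ < e.symm {i} := e.symm.strictMono (by simp)
      exact lt_of_le_of_lt (e.symm ∅).2 h
    have hinf : (e.symm {0}).1 ⊓ (e.symm {1}).1 = H := by
      have h : e.symm {0} ⊓ e.symm {1} = ⊥ := by
        rw [← e.symm.map_inf, ← e.symm.map_bot]; rfl
      exact congrArg Subtype.val h
    have hsup : (e.symm {0}).1 ⊔ (e.symm {1}).1 = ⊤ := by
      have h : e.symm {0} ⊔ e.symm {1} = ⊤ := by
        rw [← e.symm.map_sup, ← e.symm.map_top]; rfl
      exact congrArg Subtype.val h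
    have hK (K : Subgroup G) (h : H ≤ K) :
        K = H ∨ K = (e.symm {0}).1 ∨ K = (e.symm {1}).1 ∨ K = ⊤ := by
      have hcases : ∀ I : Finset (Fin 2), I = ∅ ∨ I = {0} ∨ I = {1} ∨ I = {0, 1} := by decide
      have hKe : K = (e.symm (e ⟨K, h⟩)).1 := by rw [e.symm_apply_apply]
      rcases hcases (e ⟨K, h⟩) with hI | hI | hI | hI <;> rw [hI] at hKe
      · exact Or.inl (hKe.trans hbot)
      · exact Or.inr (Or.inl hKe)
      · exact Or.inr (Or.inr (Or.inl hKe))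
      · exact Or.inr (Or.inr (Or.inr (hKe.trans htop)))
    have h := Subgroup.index_add_index_lt_index (hlt 0) (hlt 1) hinf hsup hK
    rw [dualEulerTotient_rank_two]
    norm_num
    omega
end
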